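/- Let p be a prime with p > 5 and let z = z(p) be the entry point of p in the Fibonacci sequence. For every natural number n, the Fibonacci quaternion F_n is a zero divisor in H[Z_p] (equivalently, F_n is not a unit) if and only if there exists a natural number l with 2n + 3 = (2l + 1)·z. -/

import Mathlib

open Quaternion

/-- The n-th Fibonacci quaternion over a commutative ring `R`:
`F_n = f_n + f_{n+1}·i + f_{n+2}·j + f_{n+3}·k` in `ℍ[R] = H(-1,-1)`. -/
def fibQuat (R : Type*) [CommRing R] (n : ℕ) : ℍ[R] :=
  ⟨(Nat.fib n : R), (Nat.fib (n + 1) : R), (Nat.fib (n + 2) : R), (Nat.fib (n + 3) : R)⟩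

theorem Quaternion.isUnit_iff_isUnit_normSq {R : Type*} [CommRing R] (a : ℍ[R]) :
    IsUnit a ↔ IsUnit (normSq a) := by
  refine ⟨fun h => h.map normSq, fun h => ?_⟩
  obtain ⟨c, hc⟩ : ∃ c : R, normSq a * c = 1 := h.exists_right_inv
  have hc' : ((normSq a : R) : ℍ[R]) * (c : ℍ[R]) = 1 := by rw [← coe_mul, hc, coe_one]
  refine isUnit_iff_exists.mpr ⟨star a * (c : ℍ[R]), ?_, ?_⟩
  · rw [← mul_assoc, self_mul_star, hc']
  · rw [mul_assoc, coe_commutes, ← mul_assoc, star_mul_self, hc']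

theorem normSq_fibQuat (R : Type*) [CommRing R] (n : ℕ) :
    normSq (fibQuat R n) = ((3 * Nat.fib (2 * n + 3) : ℕ) : R) := by
  have h : Nat.fib (2 * n + 3) = Nat.fib (n + 2) ^ 2 + Nat.fib (n + 1) ^ 2 :=
    Nat.fib_two_mul_add_one (n + 1)
  rw [h, normSq_def']
  simp only [fibQuat, Nat.fib_add_two (n := n + 1), Nat.fib_add_two (n := n)]
  push_cast
  ring

theorem Nat.dvd_fib_iff_of_isLeast {d z : ℕ} (hz : IsLeast {m | 0 < m ∧ d ∣ Nat.fib m} z)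
    (m : ℕ) : d ∣ Nat.fib m ↔ z ∣ m := by
  obtain ⟨⟨hz0, hdz⟩, hmin⟩ := hz
  refine ⟨fun h => ?_, fun h => hdz.trans (Nat.fib_dvd z m h)⟩
  have hle : z ≤ z.gcd m :=
    hmin ⟨Nat.gcd_pos_of_pos_left m hz0, Nat.fib_gcd z m ▸ Nat.dvd_gcd hdz h⟩
  exact Nat.gcd_eq_left_iff_dvd.mp (le_antisymm (Nat.gcd_le_left m hz0) hle)

theorem fibQuat_zeroDivisor_iff_entry_point (p : ℕ) (hp : p.Prime) (hp5 : 5 < p)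
    (z : ℕ) (hz : IsLeast {m | 0 < m ∧ p ∣ Nat.fib m} z) (n : ℕ) :
    ¬ IsUnit (fibQuat (ZMod p) n) ↔ ∃ l : ℕ, 2 * n + 3 = (2 * l + 1) * z := by
  have : Fact p.Prime := ⟨hp⟩
  have hp3 : ¬ p ∣ 3 := fun h => by
    have := Nat.le_of_dvd (by norm_num) h
    omega
  rw [Quaternion.isUnit_iff_isUnit_normSq, normSq_fibQuat, isUnit_iff_ne_zero, not_not,
    ZMod.natCast_eq_zero_iff, hp.dvd_mul, or_iff_right hp3, Nat.dvd_fib_iff_of_isLeast hz]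
  constructor
  · rintro ⟨c, hc⟩
    have hodd : Odd (z * c) := hc ▸ ⟨n + 1, by ring⟩
    obtain ⟨l, rfl⟩ := (Nat.odd_mul.mp hodd).2
    exact ⟨l, by rw [hc, mul_comm]⟩
  · rintro ⟨l, hl⟩
    exact ⟨2 * l + 1, by rw [hl, mul_comm]⟩
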